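/- arXiv:2407.17005 — 2 statements merged into one kernel-verified Lean document; each statement's English description precedes it below -/
import Mathlib

section
/- Let k be a field of characteristic 0, G an affine algebraic group over k, R a k-algebra, and suppose for every finite-dimensional representation V of G we are given an R-linear map λ_V : V⊗_k R → V⊗_k R satisfying: (C1) λ_{V⊗W} = λ_V ⊗ 1 + 1 ⊗ λ_W for all V, W; (C2) λ_𝟏 = 0 for the trivial representation 𝟏; (C3) λ_W ∘ u_R = u_R ∘ λ_V for every G-equivariant map u : V → W. Then there exists a unique element X ∈ Lie_R(G_R) such that λ_V = (Lie_R(r_{V,R}))(X) for all V. -/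
open Matrix
open scoped MatrixGroups Kronecker

universe u

/-- Membership in the linear algebraic monoid/group cut out inside `GL_N` by the set of
polynomial equations `S`. -/
def polyMem (k : Type u) [Field k] (N : ℕ) (S : Set (MvPolynomial (Fin N × Fin N) k))
    (A : Type u) [CommRing A] [Algebra k A] (g : Matrix (Fin N) (Fin N) A) : Prop :=
  ∀ p ∈ S, MvPolynomial.aeval (fun q : Fin N × Fin N => g q.1 q.2) p = 0

/-- The `A`-points of the linear algebraic group `G ⊆ GL_N` defined by `S`. -/
def GPts (k : Type u) [Field k] (N : ℕ) (S : Set (MvPolynomial (Fin N × Fin N) k))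
    (A : Type u) [CommRing A] [Algebra k A] : Type u :=
  {g : GL (Fin N) A // polyMem k N S A (g : Matrix (Fin N) (Fin N) A)}

/-- A finite-dimensional algebraic representation of `G` (in matrix form, functorial on
all commutative `k`-algebras). -/
structure RepOf (k : Type u) [Field k] (N : ℕ)
    (S : Set (MvPolynomial (Fin N × Fin N) k)) where
  d : ℕ
  r : ∀ (A : Type u) [CommRing A] [Algebra k A], GPts k N S A → Matrix (Fin d) (Fin d) A
  map_one : ∀ (A : Type u) [CommRing A] [Algebra k A] (g : GPts k N S A),
      g.1 = 1 → r A g = 1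
  map_mul : ∀ (A : Type u) [CommRing A] [Algebra k A] (g h gh : GPts k N S A),
      gh.1 = g.1 * h.1 → r A gh = r A g * r A h
  natural : ∀ (A B : Type u) [CommRing A] [Algebra k A] [CommRing B] [Algebra k B]
      (f : A →ₐ[k] B) (g : GPts k N S A) (g' : GPts k N S B),
      (g'.1 : Matrix (Fin N) (Fin N) B) =
        ((g.1 : Matrix (Fin N) (Fin N) A)).map f →
      r B g' = (r A g).map f

section Reconstruction

variable {k : Type u} [Field k] {N : ℕ} {S : Set (MvPolynomial (Fin N × Fin N) k)}

/-- The defining polynomials of `G` cut out a subgroup of `GL_N(A)` for every `A`. -/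
abbrev CutsSubgroup (k : Type u) [Field k] (N : ℕ)
    (S : Set (MvPolynomial (Fin N × Fin N) k)) : Prop :=
  ∀ (A : Type u) [CommRing A] [Algebra k A],
    ∃ H : Subgroup (GL (Fin N) A), ∀ g : GL (Fin N) A,
      g ∈ H ↔ polyMem k N S A (g : Matrix (Fin N) (Fin N) A)

theorem CutsSubgroup.exists_one (hS : CutsSubgroup k N S) (A : Type u) [CommRing A]
    [Algebra k A] : ∃ g : GPts k N S A, g.1 = 1 := by
  obtain ⟨H, hH⟩ := hS A
  exact ⟨⟨1, (hH 1).1 H.one_mem⟩, rfl⟩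

theorem CutsSubgroup.exists_mul (hS : CutsSubgroup k N S) {A : Type u} [CommRing A]
    [Algebra k A] (g h : GPts k N S A) : ∃ gh : GPts k N S A, gh.1 = g.1 * h.1 := by
  obtain ⟨H, hH⟩ := hS A
  exact ⟨⟨g.1 * h.1, (hH _).1 (H.mul_mem ((hH _).2 g.2) ((hH _).2 h.2))⟩, rfl⟩

theorem GPts.exists_map {A B : Type u} [CommRing A] [Algebra k A] [CommRing B] [Algebra k B]
    (f : A →ₐ[k] B) (g : GPts k N S A) :
    ∃ g' : GPts k N S B, (g'.1 : Matrix (Fin N) (Fin N) B) =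
      (g.1 : Matrix (Fin N) (Fin N) A).map f := by
  refine ⟨⟨Matrix.GeneralLinearGroup.map (f : A →+* B) g.1, fun p hp => ?_⟩, ?_⟩
  · have h := congrArg f (show MvPolynomial.aeval
      (fun q : Fin N × Fin N => (g.1 : Matrix (Fin N) (Fin N) A) q.1 q.2) p = 0 from g.2 p hp)
    rw [map_zero, MvPolynomial.comp_aeval_apply] at h
    exact h
  · ext i j
    rfl

/-- The pairing of a matrix over `k` with a matrix over a `k`-algebra. -/
def matrixPairing {n A : Type*} [Fintype n] [CommRing A] [Algebra k A]
    (φ : Matrix n n k) (M : Matrix n n A) : A :=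
  ∑ i, ∑ j, φ i j • M i j

/-- The matrix `1 + εL` over the dual numbers. -/
def oneAddEps {n R : Type*} [DecidableEq n] [CommRing R] (L : Matrix n n R) :
    Matrix n n (DualNumber R) :=
  1 + L.map (fun a => (TrivSqZeroExt.inr a : DualNumber R))

theorem oneAddEps_kronecker {m n R : Type*} [DecidableEq m] [DecidableEq n] [CommRing R]
    (L : Matrix m m R) (M : Matrix n n R) :
    oneAddEps L ⊗ₖ oneAddEps M = oneAddEps (L ⊗ₖ 1 + 1 ⊗ₖ M) := by
  ext ⟨i, i'⟩ ⟨j, j'⟩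
  · by_cases h : i = j <;> by_cases h' : i' = j' <;>
      simp [oneAddEps, h, h']
  · by_cases h : i = j <;> by_cases h' : i' = j' <;>
      simp [oneAddEps, h, h', add_comm]

theorem oneAddEps_zero {n R : Type*} [DecidableEq n] [CommRing R] :
    oneAddEps (0 : Matrix n n R) = 1 := by
  rw [oneAddEps, Matrix.map_zero _ (TrivSqZeroExt.inr_zero R), add_zero]

theorem oneAddEps_injective {n R : Type*} [DecidableEq n] [CommRing R] :
    Function.Injective (oneAddEps : Matrix n n R → Matrix n n (DualNumber R)) :=
  (add_right_injective 1).comp (Matrix.map_injective TrivSqZeroExt.inr_injective)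

theorem isUnit_oneAddEps {n R : Type*} [Fintype n] [DecidableEq n] [CommRing R]
    (L : Matrix n n R) : IsUnit (oneAddEps L) := by
  refine IsNilpotent.isUnit_one_add ⟨2, ?_⟩
  ext i j <;> simp [pow_two, Matrix.mul_apply]

theorem oneAddEps_submatrix {m n R : Type*} [DecidableEq m] [DecidableEq n] [CommRing R]
    (L : Matrix n n R) (e : m ≃ n) :
    (oneAddEps L).submatrix e e = oneAddEps (L.submatrix e e) := by
  ext i j <;> simp [oneAddEps, Matrix.one_apply]

theorem submatrix_equiv_submatrix_symm {m n A : Type*} (e : m ≃ n) (M : Matrix m m A) :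
    (M.submatrix e.symm e.symm).submatrix e e = M := by
  ext i j
  simp

theorem submatrix_symm_submatrix_equiv {m n A : Type*} (e : m ≃ n) (M : Matrix n n A) :
    (M.submatrix e e).submatrix e.symm e.symm = M := by
  ext i j
  simp

theorem matrixPairing_submatrix {m n A : Type*} [Fintype m] [Fintype n] [CommRing A]
    [Algebra k A] (φ : Matrix n n k) (M : Matrix n n A) (e : m ≃ n) :
    matrixPairing (φ.submatrix e e) (M.submatrix e e) = matrixPairing φ M := by
  simp only [matrixPairing, Matrix.submatrix_apply]
  rw [e.sum_comp (fun i => ∑ j, φ i (e j) • M i (e j))]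
  exact Finset.sum_congr rfl fun i _ => e.sum_comp (fun j => φ i j • M i j)

theorem matrixPairing_kronecker {m n A : Type*} [Fintype m] [Fintype n] [CommRing A]
    [Algebra k A] (φ : Matrix m m k) (ψ : Matrix n n k) (L : Matrix m m A) (M : Matrix n n A) :
    matrixPairing (φ ⊗ₖ ψ) (L ⊗ₖ M) = matrixPairing φ L * matrixPairing ψ M := by
  simp only [matrixPairing, Fintype.sum_prod_type, Matrix.kroneckerMap_apply,
    Finset.sum_mul_sum]
  refine Finset.sum_congr rfl fun i _ => Finset.sum_congr rfl fun i' _ => ?_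
  refine Finset.sum_congr rfl fun j _ => Finset.sum_congr rfl fun j' _ => ?_
  rw [smul_mul_smul_comm]

theorem matrixPairing_fromBlocks {m n A : Type*} [Fintype m] [Fintype n] [CommRing A]
    [Algebra k A] (φ : Matrix m m k) (ψ : Matrix n n k) (L : Matrix m m A) (M : Matrix n n A) :
    matrixPairing (Matrix.fromBlocks φ 0 0 ψ) (Matrix.fromBlocks L 0 0 M) =
      matrixPairing φ L + matrixPairing ψ M := by
  simp [matrixPairing]

theorem matrixPairing_oneAddEps {n R : Type*} [Fintype n] [DecidableEq n] [CommRing R]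
    [Algebra k R] (φ : Matrix n n k) (L : Matrix n n R) :
    matrixPairing φ (oneAddEps L) =
      TrivSqZeroExt.inl (algebraMap k R (matrixPairing φ (1 : Matrix n n k))) +
        TrivSqZeroExt.inr (matrixPairing φ L) := by
  ext
  · simp only [matrixPairing, TrivSqZeroExt.fst_sum, TrivSqZeroExt.fst_add,
      TrivSqZeroExt.fst_inl, TrivSqZeroExt.fst_inr, add_zero, map_sum]
    refine Finset.sum_congr rfl fun i _ => Finset.sum_congr rfl fun j _ => ?_
    by_cases h : i = j <;> simp [oneAddEps, Matrix.one_apply, h, Algebra.algebraMap_eq_smul_one]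
  · simp only [matrixPairing, TrivSqZeroExt.snd_sum, TrivSqZeroExt.snd_add,
      TrivSqZeroExt.snd_inl, TrivSqZeroExt.snd_inr, zero_add]
    refine Finset.sum_congr rfl fun i _ => Finset.sum_congr rfl fun j _ => ?_
    by_cases h : i = j <;> simp [oneAddEps, h]

/-- The tautological representation of `G ⊆ GL_N`. -/
def RepOf.std (k : Type u) [Field k] (N : ℕ) (S : Set (MvPolynomial (Fin N × Fin N) k)) :
    RepOf k N S where
  d := N
  r _ _ _ g := g.1
  map_one _ _ _ _ h := by rw [h]; rfl
  map_mul _ _ _ _ _ _ e := by rw [e]; rfl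
  natural _ _ _ _ _ _ _ _ _ h := h

/-- The trivial representation of dimension `n`. -/
def RepOf.trivial (k : Type u) [Field k] (N : ℕ) (S : Set (MvPolynomial (Fin N × Fin N) k))
    (n : ℕ) : RepOf k N S where
  d := n
  r _ _ _ _ := 1
  map_one _ _ _ _ _ := rfl
  map_mul _ _ _ _ _ _ _ := (one_mul 1).symm
  natural _ _ _ _ _ _ f _ _ _ := (Matrix.map_one f (_root_.map_zero f) (_root_.map_one f)).symm

/-- The tensor product of two representations. -/
def RepOf.tensor (ρ σ : RepOf k N S) : RepOf k N S where
  d := ρ.d * σ.d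
  r A _ _ g := (ρ.r A g ⊗ₖ σ.r A g).submatrix finProdFinEquiv.symm finProdFinEquiv.symm
  map_one A _ _ g h := by
    rw [ρ.map_one A g h, σ.map_one A g h, Matrix.one_kronecker_one,
      Matrix.submatrix_one_equiv]
  map_mul A _ _ g h gh e := by
    rw [ρ.map_mul A g h gh e, σ.map_mul A g h gh e, Matrix.mul_kronecker_mul,
      Matrix.submatrix_mul_equiv]
  natural A B _ _ _ _ f g g' h := by
    rw [ρ.natural A B f g g' h, σ.natural A B f g g' h]
    ext i j
    simp

/-- The direct sum of two representations. -/
def RepOf.directSum (ρ σ : RepOf k N S) : RepOf k N S where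
  d := ρ.d + σ.d
  r A _ _ g := (Matrix.fromBlocks (ρ.r A g) 0 0 (σ.r A g)).submatrix
    finSumFinEquiv.symm finSumFinEquiv.symm
  map_one A _ _ g h := by
    rw [ρ.map_one A g h, σ.map_one A g h, Matrix.fromBlocks_one,
      Matrix.submatrix_one_equiv]
  map_mul A _ _ g h gh e := by
    rw [ρ.map_mul A g h gh e, σ.map_mul A g h gh e, Matrix.submatrix_mul_equiv,
      Matrix.fromBlocks_multiply]
    simp
  natural A B _ _ _ _ f g g' h := by
    rw [ρ.natural A B f g g' h, σ.natural A B f g g' h, ← Matrix.submatrix_map,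
      Matrix.fromBlocks_map, Matrix.map_zero _ (_root_.map_zero f),
      Matrix.map_zero _ (_root_.map_zero f)]

/-- A representation on a direct summand `k^n` (embedded by `B`, with retraction `C`) that is
stable under `G`. -/
def RepOf.restrict (σ : RepOf k N S) {n : ℕ} (B : Matrix (Fin σ.d) (Fin n) k)
    (C : Matrix (Fin n) (Fin σ.d) k) (hCB : C * B = 1)
    (hB : ∀ (A : Type u) [CommRing A] [Algebra k A] (g : GPts k N S A),
      (B * C).map (algebraMap k A) * (σ.r A g * B.map (algebraMap k A)) =
        σ.r A g * B.map (algebraMap k A)) : RepOf k N S where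
  d := n
  r A _ _ g := C.map (algebraMap k A) * (σ.r A g * B.map (algebraMap k A))
  map_one A _ _ g h := by
    rw [σ.map_one A g h, Matrix.one_mul, ← Matrix.map_mul, hCB,
      Matrix.map_one _ (_root_.map_zero _) (_root_.map_one _)]
  map_mul A _ _ g h gh e := by
    conv_lhs => rw [σ.map_mul A g h gh e, Matrix.mul_assoc, ← hB A h]
    simp only [Matrix.map_mul, Matrix.mul_assoc]
  natural A B' _ _ _ _ f g g' h := by
    have key (m n : ℕ) (M : Matrix (Fin m) (Fin n) k) :
        (M.map (algebraMap k A)).map f = M.map (algebraMap k B') := by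
      ext i j
      simp
    rw [σ.natural A B' f g g' h, Matrix.map_mul, Matrix.map_mul, key, key]

/-- The hypotheses of additive Tannakian reconstruction: a family of endomorphisms of the
representations of `G`, additive on tensor products, zero on trivial representations and
commuting with equivariant maps. -/
structure IsTensorDerivation {R : Type u} [CommRing R] [Algebra k R]
    (lam : (ρ : RepOf k N S) → Matrix (Fin ρ.d) (Fin ρ.d) R) : Prop where
  tensor : ∀ (ρ₁ ρ₂ ρ₁₂ : RepOf k N S) (e : Fin ρ₁₂.d ≃ Fin ρ₁.d × Fin ρ₂.d),
    (∀ (A : Type u) [CommRing A] [Algebra k A] (g : GPts k N S A),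
      (ρ₁₂.r A g).submatrix e.symm e.symm = (ρ₁.r A g) ⊗ₖ (ρ₂.r A g)) →
    (lam ρ₁₂).submatrix e.symm e.symm =
      (lam ρ₁) ⊗ₖ (1 : Matrix (Fin ρ₂.d) (Fin ρ₂.d) R) +
      (1 : Matrix (Fin ρ₁.d) (Fin ρ₁.d) R) ⊗ₖ (lam ρ₂)
  trivial : ∀ ρ : RepOf k N S,
    (∀ (A : Type u) [CommRing A] [Algebra k A] (g : GPts k N S A), ρ.r A g = 1) →
    lam ρ = 0
  equivariant : ∀ (ρ₁ ρ₂ : RepOf k N S) (u : Matrix (Fin ρ₂.d) (Fin ρ₁.d) k),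
    (∀ (A : Type u) [CommRing A] [Algebra k A] (g : GPts k N S A),
      ρ₂.r A g * u.map (algebraMap k A) = u.map (algebraMap k A) * ρ₁.r A g) →
    lam ρ₂ * u.map (algebraMap k R) = u.map (algebraMap k R) * lam ρ₁

open TensorProduct in
/-- Let `φ` vanish on the orbit of `v`. Then so do the coefficients, along any linear functional,
of the translates of `φ` by points of `G`. -/
theorem CutsSubgroup.relation_mul (hS : CutsSubgroup k N S) (σ : RepOf k N S)
    (v φ : Fin σ.d → k)
    (hφ : ∀ (A : Type u) [CommRing A] [Algebra k A] (g : GPts k N S A),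
      (algebraMap k A ∘ φ) ⬝ᵥ (σ.r A g *ᵥ (algebraMap k A ∘ v)) = 0)
    {A : Type u} [CommRing A] [Algebra k A] (g : GPts k N S A) (ℓ : Module.Dual k A)
    (B : Type u) [CommRing B] [Algebra k B] (h : GPts k N S B) :
    (algebraMap k B ∘ fun j => ℓ (((algebraMap k A ∘ φ) ᵥ* σ.r A g) j)) ⬝ᵥ
      (σ.r B h *ᵥ (algebraMap k B ∘ v)) = 0 := by
  obtain ⟨g', hg'⟩ := g.exists_map
    (Algebra.TensorProduct.includeLeft : A →ₐ[k] A ⊗[k] B)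
  obtain ⟨h', hh'⟩ := h.exists_map
    (Algebra.TensorProduct.includeRight : B →ₐ[k] A ⊗[k] B)
  obtain ⟨p, hp⟩ := hS.exists_mul g' h'
  have H := hφ _ p
  rw [σ.map_mul _ _ _ _ hp, σ.natural _ _ _ _ _ hg', σ.natural _ _ _ _ _ hh',
    ← Matrix.mulVec_mulVec, Matrix.dotProduct_mulVec] at H
  have H1 : (algebraMap k (A ⊗[k] B) ∘ φ) ᵥ*
        (σ.r A g).map (Algebra.TensorProduct.includeLeft : A →ₐ[k] A ⊗[k] B) =
      fun j => ((algebraMap k A ∘ φ) ᵥ* σ.r A g) j ⊗ₜ[k] (1 : B) := by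
    ext j
    simp [Matrix.vecMul, dotProduct, TensorProduct.sum_tmul,
      Algebra.TensorProduct.algebraMap_apply]
  have H2 : (σ.r B h).map (Algebra.TensorProduct.includeRight : B →ₐ[k] A ⊗[k] B) *ᵥ
        (algebraMap k (A ⊗[k] B) ∘ v) =
      fun j => (1 : A) ⊗ₜ[k] (σ.r B h *ᵥ (algebraMap k B ∘ v)) j := by
    ext j
    simp only [Matrix.mulVec, dotProduct, TensorProduct.tmul_sum, Matrix.map_apply,
      Function.comp_apply, Algebra.TensorProduct.algebraMap_apply',
      Algebra.TensorProduct.includeRight_apply, Algebra.TensorProduct.tmul_mul_tmul, mul_one]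
  rw [H1, H2] at H
  have H3 := congrArg ((TensorProduct.lid k B).toLinearMap ∘ₗ ℓ.rTensor B) H
  simpa [dotProduct, Algebra.smul_def] using H3

theorem IsTensorDerivation.exists_restrict {R : Type u} [CommRing R] [Algebra k R]
    {lam : (ρ : RepOf k N S) → Matrix (Fin ρ.d) (Fin ρ.d) R} (hlam : IsTensorDerivation lam)
    (σ : RepOf k N S) {n : ℕ} (B : Matrix (Fin σ.d) (Fin n) k)
    (C : Matrix (Fin n) (Fin σ.d) k) (hCB : C * B = 1)
    (hB : ∀ (A : Type u) [CommRing A] [Algebra k A] (g : GPts k N S A),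
      (B * C).map (algebraMap k A) * (σ.r A g * B.map (algebraMap k A)) =
        σ.r A g * B.map (algebraMap k A)) :
    ∃ L : Matrix (Fin n) (Fin n) R,
      lam σ * B.map (algebraMap k R) = B.map (algebraMap k R) * L := by
  refine ⟨lam (σ.restrict B C hCB hB),
    hlam.equivariant (σ.restrict B C hCB hB) σ B fun A _ _ g => ?_⟩
  have h := hB A g
  rw [Matrix.map_mul, Matrix.mul_assoc] at h
  exact h.symm

/-- A linear relation satisfied by the orbit of `v` is satisfied by the image of `v` under
`lam`: the smallest subrepresentation containing `v` is stable under `lam`. -/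
theorem IsTensorDerivation.relation {R : Type u} [CommRing R] [Algebra k R]
    {lam : (ρ : RepOf k N S) → Matrix (Fin ρ.d) (Fin ρ.d) R} (hlam : IsTensorDerivation lam)
    (hS : CutsSubgroup k N S) (σ : RepOf k N S) (v φ : Fin σ.d → k)
    (hφ : ∀ (A : Type u) [CommRing A] [Algebra k A] (g : GPts k N S A),
      (algebraMap k A ∘ φ) ⬝ᵥ (σ.r A g *ᵥ (algebraMap k A ∘ v)) = 0) :
    (algebraMap k R ∘ φ) ⬝ᵥ (lam σ *ᵥ (algebraMap k R ∘ v)) = 0 := by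
  let rel : Submodule k (Module.Dual k (Fin σ.d → k)) :=
    { carrier := {ψ | ∀ (A : Type u) [CommRing A] [Algebra k A] (g : GPts k N S A),
        (fun i => algebraMap k A (ψ (Pi.single i 1))) ⬝ᵥ
          (σ.r A g *ᵥ (algebraMap k A ∘ v)) = 0}
      zero_mem' := fun A _ _ g => by simp [dotProduct]
      add_mem' := fun {ψ χ} hψ hχ A _ _ g => by
        have := congrArg₂ (· + ·) (hψ A g) (hχ A g)
        simpa [← add_dotProduct, Pi.add_def] using this
      smul_mem' := fun c ψ hψ A _ _ g => by
        have := congrArg (algebraMap k A c * ·) (hψ A g)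
        simpa [dotProduct, Finset.mul_sum, mul_assoc] using this }
  have mem_rel (ψ : Fin σ.d → k) (hψ : ∀ (A : Type u) [CommRing A] [Algebra k A]
      (g : GPts k N S A), (algebraMap k A ∘ ψ) ⬝ᵥ (σ.r A g *ᵥ (algebraMap k A ∘ v)) = 0) :
      dotProductEquiv k (Fin σ.d) ψ ∈ rel := by
    intro A _ _ g
    simpa [Function.comp_def] using hψ A g
  let W : Submodule k (Fin σ.d → k) := rel.dualCoannihilator
  have hvW : v ∈ W := by
    rw [Submodule.mem_dualCoannihilator]
    intro ψ hψ
    obtain ⟨g, hg⟩ := hS.exists_one k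
    have := hψ k g
    rw [σ.map_one k g hg] at this
    have hψv : ψ v = ∑ i, ψ (Pi.single i 1) * v i := by
      conv_lhs => rw [← Finset.univ_sum_single v]
      rw [map_sum]
      refine Finset.sum_congr rfl fun i _ => ?_
      rw [mul_comm, ← smul_eq_mul, ← map_smul, ← Pi.single_smul, smul_eq_mul, mul_one]
    rw [hψv]
    simpa [dotProduct] using this
  let b := Module.finBasis k W
  let ι : (Fin (Module.finrank k W) → k) →ₗ[k] (Fin σ.d → k) :=
    W.subtype ∘ₗ b.equivFun.symm.toLinearMap
  have hι : Function.Injective ι := W.subtype_injective.comp b.equivFun.symm.injective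
  obtain ⟨c, hc⟩ := ι.exists_leftInverse_of_injective (LinearMap.ker_eq_bot.2 hι)
  set B := LinearMap.toMatrix' ι with hBdef
  set C := LinearMap.toMatrix' c
  have hCB : C * B = 1 := by
    rw [← LinearMap.toMatrix'_comp, hc, LinearMap.toMatrix'_id]
  have hBW (x) : B *ᵥ x ∈ W := by
    rw [hBdef, LinearMap.toMatrix'_mulVec]
    exact (b.equivFun.symm x).2
  have hWB {w} (hw : w ∈ W) : ∃ x, B *ᵥ x = w := by
    refine ⟨b.equivFun ⟨w, hw⟩, ?_⟩
    rw [hBdef, LinearMap.toMatrix'_mulVec]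
    simp [ι]
  -- a functional vanishing on `W` is a relation
  have hdouble (ψ : Fin σ.d → k) (hψ : ψ ᵥ* B = 0) :
      ∀ (A : Type u) [CommRing A] [Algebra k A] (g : GPts k N S A),
        (algebraMap k A ∘ ψ) ⬝ᵥ (σ.r A g *ᵥ (algebraMap k A ∘ v)) = 0 := by
    have : dotProductEquiv k (Fin σ.d) ψ ∈ W.dualAnnihilator := by
      rw [Submodule.mem_dualAnnihilator]
      intro w hw
      obtain ⟨x, rfl⟩ := hWB hw
      simp [Matrix.dotProduct_mulVec, hψ]
    rw [Subspace.dualCoannihilator_dualAnnihilator_eq] at this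
    intro A _ _ g
    simpa [Function.comp_def] using this A g
  have hzero (ψ : Fin σ.d → k) (hψ : ∀ (A : Type u) [CommRing A] [Algebra k A]
      (g : GPts k N S A), (algebraMap k A ∘ ψ) ⬝ᵥ (σ.r A g *ᵥ (algebraMap k A ∘ v)) = 0) :
      ψ ᵥ* B = 0 := by
    refine dotProduct_eq_zero _ fun x => ?_
    rw [← Matrix.dotProduct_mulVec]
    exact (Submodule.mem_dualCoannihilator _).1 (hBW x) _ (mem_rel ψ hψ)
  have hstable (ψ : Fin σ.d → k) (hψ : ψ ᵥ* B = 0) (A : Type u) [CommRing A] [Algebra k A]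
      (g : GPts k N S A) :
      (algebraMap k A ∘ ψ) ᵥ* (σ.r A g * B.map (algebraMap k A)) = 0 := by
    rw [← Matrix.vecMul_vecMul]
    ext x
    rw [Pi.zero_apply, ← Module.forall_dual_apply_eq_zero_iff k]
    intro ℓ
    have := congrFun (hzero _ fun A' _ _ h =>
      hS.relation_mul σ v ψ (hdouble ψ hψ) g ℓ A' h) x
    rw [Pi.zero_apply] at this
    rw [← this, Matrix.vecMul, Matrix.vecMul, dotProduct, dotProduct, map_sum]
    refine Finset.sum_congr rfl fun i _ => ?_
    rw [Matrix.map_apply, mul_comm, ← Algebra.smul_def, map_smul, smul_eq_mul, mul_comm]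
  have hBC (A : Type u) [CommRing A] [Algebra k A] (g : GPts k N S A) :
      (B * C).map (algebraMap k A) * (σ.r A g * B.map (algebraMap k A)) =
        σ.r A g * B.map (algebraMap k A) := by
    rw [eq_comm, ← sub_eq_zero]
    set P : Matrix (Fin σ.d) (Fin σ.d) k := 1 - B * C with hP
    have h1 : P * B = 0 := by
      rw [hP, Matrix.sub_mul, Matrix.mul_assoc, hCB, Matrix.one_mul, Matrix.mul_one, sub_self]
    have h2 : P.map (algebraMap k A) * (σ.r A g * B.map (algebraMap k A)) = 0 := by
      ext i j
      exact congrFun (hstable (fun l => P i l) (congrFun h1 i) A g) j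
    rw [hP, Matrix.map_sub _ (fun a b => map_sub _ a b),
      Matrix.map_one _ (map_zero _) (map_one _), Matrix.sub_mul, Matrix.one_mul] at h2
    exact h2
  obtain ⟨L, hL⟩ := hlam.exists_restrict σ B C hCB hBC
  obtain ⟨x, hx⟩ := hWB hvW
  have hv : algebraMap k R ∘ v = B.map (algebraMap k R) *ᵥ (algebraMap k R ∘ x) := by
    ext i
    rw [← hx]
    exact RingHom.map_mulVec (algebraMap k R) B x i
  have hφB : (algebraMap k R ∘ φ) ᵥ* B.map (algebraMap k R) = 0 := by
    ext i
    have := (RingHom.map_vecMul (algebraMap k R) B φ i).symm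
    rwa [hzero φ hφ, Pi.zero_apply, map_zero] at this
  rw [hv, Matrix.mulVec_mulVec, hL, ← Matrix.mulVec_mulVec, Matrix.dotProduct_mulVec, hφB,
    zero_dotProduct]

theorem IsTensorDerivation.matrixPairing_eq_zero {R : Type u} [CommRing R] [Algebra k R]
    {lam : (ρ : RepOf k N S) → Matrix (Fin ρ.d) (Fin ρ.d) R} (hlam : IsTensorDerivation lam)
    (hS : CutsSubgroup k N S) (ρ : RepOf k N S) (φ : Matrix (Fin ρ.d) (Fin ρ.d) k)
    (hφ : ∀ (A : Type u) [CommRing A] [Algebra k A] (g : GPts k N S A),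
      matrixPairing φ (ρ.r A g) = 0) :
    matrixPairing φ (lam ρ) = 0 := by
  let e : Fin (ρ.d * ρ.d) ≃ Fin ρ.d × Fin ρ.d := finProdFinEquiv.symm
  have key (A : Type u) [CommRing A] [Algebra k A] (M : Matrix (Fin ρ.d) (Fin ρ.d) A) :
      (algebraMap k A ∘ fun i => φ (e i).1 (e i).2) ⬝ᵥ
        ((M ⊗ₖ (1 : Matrix (Fin ρ.d) (Fin ρ.d) A)).submatrix e e *ᵥ
          (algebraMap k A ∘ fun i => (1 : Matrix (Fin ρ.d) (Fin ρ.d) k) (e i).1 (e i).2)) =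
      matrixPairing φ M := by
    simp only [dotProduct, Matrix.mulVec, Matrix.submatrix_apply, Function.comp_apply]
    have inner (y : Fin ρ.d × Fin ρ.d) :
        ∑ j, (M ⊗ₖ (1 : Matrix (Fin ρ.d) (Fin ρ.d) A)) y (e j) *
          algebraMap k A ((1 : Matrix (Fin ρ.d) (Fin ρ.d) k) (e j).1 (e j).2) =
        ∑ x, (M ⊗ₖ (1 : Matrix (Fin ρ.d) (Fin ρ.d) A)) y x *
          algebraMap k A ((1 : Matrix (Fin ρ.d) (Fin ρ.d) k) x.1 x.2) :=
      e.sum_comp (fun x => (M ⊗ₖ (1 : Matrix (Fin ρ.d) (Fin ρ.d) A)) y x *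
        algebraMap k A ((1 : Matrix (Fin ρ.d) (Fin ρ.d) k) x.1 x.2))
    simp only [inner]
    rw [e.sum_comp (fun y => algebraMap k A (φ y.1 y.2) *
      ∑ x, (M ⊗ₖ (1 : Matrix (Fin ρ.d) (Fin ρ.d) A)) y x *
        algebraMap k A ((1 : Matrix (Fin ρ.d) (Fin ρ.d) k) x.1 x.2))]
    simp [Fintype.sum_prod_type, matrixPairing, Matrix.one_apply, Algebra.smul_def]
  have h := hlam.relation hS (ρ.tensor (RepOf.trivial k N S ρ.d))
    (fun i => (1 : Matrix (Fin ρ.d) (Fin ρ.d) k) (e i).1 (e i).2)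
    (fun i => φ (e i).1 (e i).2)
    (fun A _ _ g => (key A (ρ.r A g)).trans (hφ A g))
  have ht := hlam.tensor ρ (RepOf.trivial k N S ρ.d) (ρ.tensor (RepOf.trivial k N S ρ.d)) e
    (fun A _ _ g => submatrix_symm_submatrix_equiv e (ρ.r A g ⊗ₖ (1 : Matrix _ _ A)))
  rw [hlam.trivial (RepOf.trivial k N S ρ.d) (fun _ _ _ _ => rfl), Matrix.kronecker_zero,
    add_zero] at ht
  have ht' : lam (ρ.tensor (RepOf.trivial k N S ρ.d)) =
      (lam ρ ⊗ₖ (1 : Matrix (Fin ρ.d) (Fin ρ.d) R)).submatrix e e := by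
    exact (submatrix_equiv_submatrix_symm e _).symm.trans (congrArg (fun M => M.submatrix e e) ht)
  rw [ht'] at h
  exact (key R (lam ρ)).symm.trans h

theorem IsTensorDerivation.directSum {R : Type u} [CommRing R] [Algebra k R]
    {lam : (ρ : RepOf k N S) → Matrix (Fin ρ.d) (Fin ρ.d) R} (hlam : IsTensorDerivation lam)
    (ρ σ : RepOf k N S) :
    lam (ρ.directSum σ) = (Matrix.fromBlocks (lam ρ) 0 0 (lam σ)).submatrix
      finSumFinEquiv.symm finSumFinEquiv.symm := by
  let e : Fin (ρ.d + σ.d) ≃ Fin ρ.d ⊕ Fin σ.d := finSumFinEquiv.symm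
  let L : Matrix (Fin ρ.d ⊕ Fin σ.d) (Fin ρ.d ⊕ Fin σ.d) R :=
    Matrix.submatrix (lam (ρ.directSum σ)) e.symm e.symm
  have hL : lam (ρ.directSum σ) = L.submatrix e e :=
    (submatrix_equiv_submatrix_symm e _).symm
  suffices h : L = Matrix.fromBlocks (lam ρ) 0 0 (lam σ) by
    exact hL.trans (congrArg (fun M => M.submatrix e e) h)
  have inclusion {n : ℕ} (u : Matrix (Fin ρ.d ⊕ Fin σ.d) (Fin n) k) (A : Type u) [CommRing A]
      [Algebra k A] (M : Matrix (Fin ρ.d ⊕ Fin σ.d) (Fin ρ.d ⊕ Fin σ.d) A)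
      (M' : Matrix (Fin n) (Fin n) A) :
      M.submatrix e e * (u.submatrix e id).map (algebraMap k A) =
          (u.submatrix e id).map (algebraMap k A) * M' ↔
        M * u.map (algebraMap k A) = u.map (algebraMap k A) * M' := by
    have h1 : M.submatrix e e * (u.submatrix e id).map (algebraMap k A) =
        (M * u.map (algebraMap k A)).submatrix e id := by
      rw [← Matrix.submatrix_map, Matrix.submatrix_mul_equiv]
    have h2 : (u.submatrix e id).map (algebraMap k A) * M' =
        (u.map (algebraMap k A) * M').submatrix e id := by
      rfl
    rw [h1, h2]
    refine ⟨fun h => ?_, fun h => by rw [h]⟩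
    ext i j
    simpa using congrFun (congrFun h (e.symm i)) j
  have hl := hlam.equivariant ρ (ρ.directSum σ) ((Matrix.fromRows 1 0).submatrix e id)
    fun A _ _ g => (inclusion _ A _ (ρ.r A g)).2 (by
      rw [Matrix.fromRows_map, Matrix.map_one _ (map_zero _) (map_one _),
        Matrix.map_zero _ (map_zero _), Matrix.fromBlocks_mul_fromRows, Matrix.fromRows_mul]
      simp)
  have hr := hlam.equivariant σ (ρ.directSum σ) ((Matrix.fromRows 0 1).submatrix e id)
    fun A _ _ g => (inclusion _ A _ (σ.r A g)).2 (by
      rw [Matrix.fromRows_map, Matrix.map_one _ (map_zero _) (map_one _),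
        Matrix.map_zero _ (map_zero _), Matrix.fromBlocks_mul_fromRows, Matrix.fromRows_mul]
      simp)
  rw [hL] at hl hr
  replace hl := (inclusion _ R L (lam ρ)).1 hl
  replace hr := (inclusion _ R L (lam σ)).1 hr
  rw [Matrix.fromRows_map, Matrix.map_one _ (map_zero _) (map_one _),
    Matrix.map_zero _ (map_zero _), ← Matrix.fromBlocks_toBlocks L,
    Matrix.fromBlocks_mul_fromRows, Matrix.fromRows_mul, Matrix.fromRows_inj.eq_iff] at hl hr
  rw [← Matrix.fromBlocks_toBlocks L]
  simp only [Matrix.mul_one, Matrix.mul_zero, Matrix.one_mul, Matrix.zero_mul, add_zero,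
    zero_add] at hl hr
  rw [hl.1, hl.2, hr.1, hr.2]

/-- `IsCoefficient lam f y` says that the natural function `f` on `G` is a matrix coefficient of
a representation `ρ`, and that `y` is the same coefficient of `1 + ε (lam ρ)`. -/
def IsCoefficient {R : Type u} [CommRing R] [Algebra k R]
    (lam : (ρ : RepOf k N S) → Matrix (Fin ρ.d) (Fin ρ.d) R)
    (f : ∀ (A : Type u) [CommRing A] [Algebra k A], GPts k N S A → A) (y : DualNumber R) :
    Prop :=
  ∃ (ρ : RepOf k N S) (φ : Matrix (Fin ρ.d) (Fin ρ.d) k),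
    (∀ (A : Type u) [CommRing A] [Algebra k A] (g : GPts k N S A),
      f A g = matrixPairing φ (ρ.r A g)) ∧
    y = matrixPairing φ (oneAddEps (lam ρ))

namespace IsCoefficient

variable {R : Type u} [CommRing R] [Algebra k R]
  {lam : (ρ : RepOf k N S) → Matrix (Fin ρ.d) (Fin ρ.d) R}
  {f f' : ∀ (A : Type u) [CommRing A] [Algebra k A], GPts k N S A → A} {y y' : DualNumber R}

theorem entry (lam : (ρ : RepOf k N S) → Matrix (Fin ρ.d) (Fin ρ.d) R) (ρ : RepOf k N S)
    (i j : Fin ρ.d) :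
    IsCoefficient lam (fun A _ _ g => ρ.r A g i j) (oneAddEps (lam ρ) i j) := by
  refine ⟨ρ, Matrix.single i j 1, fun A _ _ g => ?_, ?_⟩ <;>
    simp [matrixPairing, Matrix.single_apply, ite_and, Finset.sum_ite_eq]

theorem const (hlam : IsTensorDerivation lam) (c : k) :
    IsCoefficient lam (fun A _ _ _ => algebraMap k A c) (algebraMap k (DualNumber R) c) := by
  have key (A : Type u) [CommRing A] [Algebra k A] :
      algebraMap k A c = matrixPairing (fun _ _ : Fin 1 => c) (1 : Matrix (Fin 1) (Fin 1) A) := by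
    simp [matrixPairing, Algebra.algebraMap_eq_smul_one]
  refine ⟨RepOf.trivial k N S 1, fun _ _ => c, fun A _ _ _ => key A, ?_⟩
  rw [hlam.trivial (RepOf.trivial k N S 1) (fun _ _ _ _ => rfl)]
  exact (key _).trans (congrArg (matrixPairing _) oneAddEps_zero.symm)

theorem add (hlam : IsTensorDerivation lam) (h : IsCoefficient lam f y)
    (h' : IsCoefficient lam f' y') :
    IsCoefficient lam (fun A _ _ g => f A g + f' A g) (y + y') := by
  obtain ⟨ρ, φ, hf, rfl⟩ := h
  obtain ⟨σ, ψ, hf', rfl⟩ := h'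
  refine ⟨ρ.directSum σ, (Matrix.fromBlocks φ 0 0 ψ).submatrix finSumFinEquiv.symm
    finSumFinEquiv.symm, fun A _ _ g => ?_, ?_⟩
  · dsimp only
    rw [hf, hf', ← matrixPairing_fromBlocks]
    exact (matrixPairing_submatrix _ _ _).symm
  · rw [hlam.directSum]
    refine Eq.trans ?_ (congrArg _ (oneAddEps_submatrix _ finSumFinEquiv.symm))
    refine Eq.trans ?_ (matrixPairing_submatrix _ _ _).symm
    rw [← matrixPairing_fromBlocks]
    congr 1
    ext (i | i) (j | j) <;> simp [oneAddEps, Matrix.one_apply]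

theorem mul (hlam : IsTensorDerivation lam) (h : IsCoefficient lam f y)
    (h' : IsCoefficient lam f' y') :
    IsCoefficient lam (fun A _ _ g => f A g * f' A g) (y * y') := by
  obtain ⟨ρ, φ, hf, rfl⟩ := h
  obtain ⟨σ, ψ, hf', rfl⟩ := h'
  refine ⟨ρ.tensor σ, (φ ⊗ₖ ψ).submatrix finProdFinEquiv.symm finProdFinEquiv.symm,
    fun A _ _ g => ?_, ?_⟩
  · dsimp only
    rw [hf, hf', ← matrixPairing_kronecker]
    exact (matrixPairing_submatrix _ _ _).symm
  · have ht := hlam.tensor ρ σ (ρ.tensor σ) finProdFinEquiv.symm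
      (fun A _ _ g => submatrix_symm_submatrix_equiv finProdFinEquiv.symm (ρ.r A g ⊗ₖ σ.r A g))
    rw [← matrixPairing_kronecker, oneAddEps_kronecker, ← ht]
    refine (matrixPairing_submatrix _ _ finProdFinEquiv.symm).symm.trans ?_
    refine congrArg (matrixPairing _) ?_
    refine (oneAddEps_submatrix _ finProdFinEquiv.symm).trans (congrArg oneAddEps ?_)
    exact submatrix_equiv_submatrix_symm finProdFinEquiv.symm _

theorem pow (hlam : IsTensorDerivation lam) (h : IsCoefficient lam f y) (n : ℕ) :
    IsCoefficient lam (fun A _ _ g => f A g ^ n) (y ^ n) := by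
  induction n with
  | zero => simpa using const hlam 1
  | succ n ih => simpa only [pow_succ] using ih.mul hlam h

theorem eq_zero (hlam : IsTensorDerivation lam) (hS : CutsSubgroup k N S)
    (h : IsCoefficient lam f y)
    (hf : ∀ (A : Type u) [CommRing A] [Algebra k A] (g : GPts k N S A), f A g = 0) :
    y = 0 := by
  obtain ⟨ρ, φ, hφ, rfl⟩ := h
  have hφ0 (A : Type u) [CommRing A] [Algebra k A] (g : GPts k N S A) :
      matrixPairing φ (ρ.r A g) = 0 := by rw [← hφ, hf]
  obtain ⟨g, hg⟩ := hS.exists_one k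
  have h1 := hφ0 k g
  rw [ρ.map_one k g hg] at h1
  rw [matrixPairing_oneAddEps, h1, hlam.matrixPairing_eq_zero hS ρ φ hφ0]
  simp

theorem unique (hlam : IsTensorDerivation lam) (hS : CutsSubgroup k N S)
    (h : IsCoefficient lam f y) (h' : IsCoefficient lam f' y')
    (hf : ∀ (A : Type u) [CommRing A] [Algebra k A] (g : GPts k N S A), f A g = f' A g) :
    y = y' := by
  have := (h.add hlam ((const hlam (-1)).mul hlam h')).eq_zero hlam hS fun A _ _ g => by
    simp [hf]
  simpa [add_neg_eq_zero] using this

theorem aeval (hlam : IsTensorDerivation lam) (p : MvPolynomial (Fin N × Fin N) k) :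
    IsCoefficient lam
      (fun A _ _ g => MvPolynomial.aeval
        (fun q : Fin N × Fin N => (g.1 : Matrix (Fin N) (Fin N) A) q.1 q.2) p)
      (MvPolynomial.aeval (fun q : Fin N × Fin N =>
        (oneAddEps (lam (RepOf.std k N S)) : Matrix (Fin N) (Fin N) _) q.1 q.2) p) := by
  induction p using MvPolynomial.induction_on with
  | C c => simpa only [MvPolynomial.aeval_C] using const hlam c
  | add p q hp hq => simpa only [map_add] using hp.add hlam hq
  | mul_X p q hp =>
    simp only [map_mul, MvPolynomial.aeval_X]
    exact hp.mul hlam (entry lam (RepOf.std k N S) q.1 q.2)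

end IsCoefficient

/-- Matrix coefficients of a representation are, up to a power of the determinant, polynomials
in the entries. -/
theorem RepOf.exists_det_pow_mul_eq_aeval (ρ : RepOf k N S) (i j : Fin ρ.d) :
    ∃ (n : ℕ) (p : MvPolynomial (Fin N × Fin N) k),
      ∀ (A : Type u) [CommRing A] [Algebra k A] (g : GPts k N S A),
        (g.1 : Matrix (Fin N) (Fin N) A).det ^ n * ρ.r A g i j =
          MvPolynomial.aeval
            (fun q : Fin N × Fin N => (g.1 : Matrix (Fin N) (Fin N) A) q.1 q.2) p := by
  let Q := MvPolynomial (Fin N × Fin N) k ⧸ Ideal.span S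
  let U : Matrix (Fin N) (Fin N) Q :=
    Matrix.of fun a b => Ideal.Quotient.mkₐ k (Ideal.span S) (MvPolynomial.X (a, b))
  let O := Localization.Away U.det
  let toO : Q →ₐ[k] O := IsScalarTower.toAlgHom k Q O
  have hdet : IsUnit (U.map toO).det := by
    rw [← AlgHom.mapMatrix_apply, ← AlgHom.map_det]
    exact IsLocalization.Away.algebraMap_isUnit U.det
  have haeval (p : MvPolynomial (Fin N × Fin N) k) :
      MvPolynomial.aeval (fun q : Fin N × Fin N => U.map toO q.1 q.2) p =
        toO (Ideal.Quotient.mkₐ k (Ideal.span S) p) := by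
    have : MvPolynomial.aeval (fun q : Fin N × Fin N => U.map toO q.1 q.2) =
        toO.comp (Ideal.Quotient.mkₐ k (Ideal.span S)) := by
      ext q
      simp only [MvPolynomial.aeval_X]
      rfl
    rw [this]
    rfl
  let u : GPts k N S O := ⟨Matrix.GeneralLinearGroup.mk'' (U.map toO) hdet, fun p hp => by
    refine (haeval p).trans ?_
    rw [Ideal.Quotient.mkₐ_eq_mk, Ideal.Quotient.eq_zero_iff_mem.2 (Ideal.subset_span hp),
      map_zero]⟩
  obtain ⟨n, x, hx⟩ := IsLocalization.Away.surj U.det (ρ.r O u i j)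
  obtain ⟨p, hp⟩ := Ideal.Quotient.mkₐ_surjective k (Ideal.span S) x
  refine ⟨n, p, fun A _ _ g => ?_⟩
  let quotLift : Q →ₐ[k] A := Ideal.Quotient.liftₐ (Ideal.span S)
    (MvPolynomial.aeval (fun q : Fin N × Fin N => (g.1 : Matrix (Fin N) (Fin N) A) q.1 q.2))
    (fun p hp => (Ideal.span_le (I := RingHom.ker (MvPolynomial.aeval
      (fun q : Fin N × Fin N => (g.1 : Matrix (Fin N) (Fin N) A) q.1 q.2)))).2
        (fun p hp => g.2 p hp) hp)
  have hquot (p : MvPolynomial (Fin N × Fin N) k) :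
      quotLift (Ideal.Quotient.mkₐ k (Ideal.span S) p) = MvPolynomial.aeval
        (fun q : Fin N × Fin N => (g.1 : Matrix (Fin N) (Fin N) A) q.1 q.2) p := rfl
  have hU : U.map quotLift = (g.1 : Matrix (Fin N) (Fin N) A) := by
    ext a b
    exact (hquot _).trans (MvPolynomial.aeval_X _ _)
  have hdetU : quotLift U.det = (g.1 : Matrix (Fin N) (Fin N) A).det := by
    rw [AlgHom.map_det, AlgHom.mapMatrix_apply, hU]
  have hunit (y : Submonoid.powers U.det) : IsUnit (quotLift y) := by
    obtain ⟨_, m, rfl⟩ := y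
    simp only [map_pow, hdetU]
    exact ((Matrix.isUnit_iff_isUnit_det _).1 g.1.isUnit).pow m
  let F : O →ₐ[k] A := IsLocalization.liftAlgHom hunit
  have hF (x : Q) : F (toO x) = quotLift x := IsLocalization.lift_eq hunit x
  have hg : (g.1 : Matrix (Fin N) (Fin N) A) = (u.1 : Matrix (Fin N) (Fin N) O).map F := by
    rw [← hU]
    ext a b
    exact (hF (U a b)).symm
  have hx' : F (ρ.r O u i j * toO U.det ^ n) = F (toO x) := congrArg F hx
  rw [_root_.map_mul, map_pow, hF, hF, hdetU, ← hp, hquot] at hx'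
  rw [ρ.natural O A F u g hg, ← hx', mul_comm]
  rfl

/-- For a tensor derivation `lam`, the point `1 + ε (lam V)` of `GL_N`, with `V` the tautological
representation, lies in `G`. -/
theorem IsTensorDerivation.exists_point {R : Type u} [CommRing R] [Algebra k R]
    {lam : (ρ : RepOf k N S) → Matrix (Fin ρ.d) (Fin ρ.d) R} (hlam : IsTensorDerivation lam)
    (hS : CutsSubgroup k N S) :
    ∃ g : GPts k N S (DualNumber R), (g.1 : Matrix (Fin N) (Fin N) (DualNumber R)) =
      (oneAddEps (lam (RepOf.std k N S)) : Matrix (Fin N) (Fin N) (DualNumber R)) :=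
  ⟨⟨(isUnit_oneAddEps (lam (RepOf.std k N S))).unit, fun p hp =>
    (IsCoefficient.aeval hlam p).eq_zero hlam hS fun _ _ _ g => g.2 p hp⟩, rfl⟩

theorem IsTensorDerivation.map_eq_oneAddEps {R : Type u} [CommRing R] [Algebra k R]
    {lam : (ρ : RepOf k N S) → Matrix (Fin ρ.d) (Fin ρ.d) R} (hlam : IsTensorDerivation lam)
    (hS : CutsSubgroup k N S) (g : GPts k N S (DualNumber R))
    (hg : (g.1 : Matrix (Fin N) (Fin N) (DualNumber R)) =
      (oneAddEps (lam (RepOf.std k N S)) : Matrix (Fin N) (Fin N) (DualNumber R)))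
    (ρ : RepOf k N S) : ρ.r (DualNumber R) g = oneAddEps (lam ρ) := by
  ext1 i j
  obtain ⟨n, p, hp⟩ := ρ.exists_det_pow_mul_eq_aeval i j
  let D : MvPolynomial (Fin N × Fin N) k := (Matrix.of fun a b => MvPolynomial.X (a, b)).det
  have hD (A : Type u) [CommRing A] [Algebra k A] (M : Matrix (Fin N) (Fin N) A) :
      MvPolynomial.aeval (fun q : Fin N × Fin N => M q.1 q.2) D = M.det := by
    rw [AlgHom.map_det]
    congr 1
    ext a b
    simp
  have h := (((IsCoefficient.aeval hlam D).pow hlam n).mul hlam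
    (IsCoefficient.entry lam ρ i j)).unique hlam hS (IsCoefficient.aeval hlam p)
      fun A _ _ g => by rw [hD, hp]
  rw [← hg, hD, ← hp] at h
  have hunit := ((Matrix.isUnit_iff_isUnit_det _).1 g.1.isUnit).pow n
  exact (hunit.mul_left_cancel h).symm

end Reconstruction


/-- **additive Tannakian reconstruction.** Let `G` be an affine algebraic
group over a field `k` of characteristic `0` and `R` a `k`-algebra. Suppose for every
finite-dimensional representation `V` of `G` we are given an `R`-linear map
`λ_V : V ⊗ R → V ⊗ R` (in matrix form `lam ρ`) satisfying (C1) tensor additivity,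
(C2) vanishing on the trivial representation, and (C3) compatibility with `G`-equivariant
maps. Then there is a unique `X ∈ Lie_R(G_R)` with `λ_V = Lie(r_V)(X)` for all `V`,
i.e. `r_V(1 + εX) = 1 + ε·λ_V` over `R[ε]`. -/
theorem stmt_6 (k : Type u) [Field k] [CharZero k] (N : ℕ)
    (S : Set (MvPolynomial (Fin N × Fin N) k))
    (hsub : ∀ (A : Type u) [CommRing A] [Algebra k A],
      ∃ H : Subgroup (GL (Fin N) A), ∀ g : GL (Fin N) A,
        g ∈ H ↔ polyMem k N S A (g : Matrix (Fin N) (Fin N) A))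
    (R : Type u) [CommRing R] [Algebra k R]
    (lam : (ρ : RepOf k N S) → Matrix (Fin ρ.d) (Fin ρ.d) R)
    -- (C1): tensor products
    (hC1 : ∀ (ρ₁ ρ₂ ρ₁₂ : RepOf k N S) (e : Fin ρ₁₂.d ≃ Fin ρ₁.d × Fin ρ₂.d),
      (∀ (A : Type u) [CommRing A] [Algebra k A] (g : GPts k N S A),
        (ρ₁₂.r A g).submatrix e.symm e.symm = (ρ₁.r A g) ⊗ₖ (ρ₂.r A g)) →
      (lam ρ₁₂).submatrix e.symm e.symm =
        (lam ρ₁) ⊗ₖ (1 : Matrix (Fin ρ₂.d) (Fin ρ₂.d) R) +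
        (1 : Matrix (Fin ρ₁.d) (Fin ρ₁.d) R) ⊗ₖ (lam ρ₂))
    -- (C2): trivial representations
    (hC2 : ∀ ρ : RepOf k N S,
      (∀ (A : Type u) [CommRing A] [Algebra k A] (g : GPts k N S A), ρ.r A g = 1) →
      lam ρ = 0)
    -- (C3): equivariant maps
    (hC3 : ∀ (ρ₁ ρ₂ : RepOf k N S) (u : Matrix (Fin ρ₂.d) (Fin ρ₁.d) k),
      (∀ (A : Type u) [CommRing A] [Algebra k A] (g : GPts k N S A),
        ρ₂.r A g * u.map (algebraMap k A) = u.map (algebraMap k A) * ρ₁.r A g) →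
      lam ρ₂ * u.map (algebraMap k R) = u.map (algebraMap k R) * lam ρ₁) :
    ∃! X : Matrix (Fin N) (Fin N) R,
      (∃ g : GPts k N S (DualNumber R),
        (g.1 : Matrix (Fin N) (Fin N) (DualNumber R)) =
          1 + X.map (fun a => (TrivSqZeroExt.inr a : DualNumber R))) ∧
      ∀ (ρ : RepOf k N S) (g : GPts k N S (DualNumber R)),
        (g.1 : Matrix (Fin N) (Fin N) (DualNumber R)) =
          1 + X.map (fun a => (TrivSqZeroExt.inr a : DualNumber R)) →
        ρ.r (DualNumber R) g =
          1 + (lam ρ).map (fun a => (TrivSqZeroExt.inr a : DualNumber R)) := by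
  have hlam : IsTensorDerivation lam := ⟨hC1, hC2, hC3⟩
  obtain ⟨g, hg⟩ := hlam.exists_point hsub
  refine ⟨lam (RepOf.std k N S), ⟨⟨g, hg⟩, fun ρ g hg => hlam.map_eq_oneAddEps hsub g hg ρ⟩, ?_⟩
  rintro X ⟨⟨g', hg'⟩, hX⟩
  exact oneAddEps_injective (hg'.symm.trans (hX (RepOf.std k N S) g' hg'))
end

section
/- Let k be a field of characteristic 0, G an affine algebraic group over k, and A a finite-dimensional k-algebra. There is a natural bijection between the set of homomorphisms of A-group schemes 𝔾_{a,A} → G_A and the set of nilpotent elements of Lie_A(G_A). -/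
open Matrix
open scoped MatrixGroups

universe u

/-- A homomorphism of `A`-group schemes `𝔾_{a,A} → G_A`, encoded functorially on
commutative `A`-algebras. -/
structure GaHom (k : Type u) [Field k] (N : ℕ) (S : Set (MvPolynomial (Fin N × Fin N) k))
    (A : Type u) [CommRing A] [Algebra k A] where
  u : ∀ (B : Type u) [CommRing B] [Algebra k B] [Algebra A B] [IsScalarTower k A B],
      B → Matrix (Fin N) (Fin N) B
  mem : ∀ (B : Type u) [CommRing B] [Algebra k B] [Algebra A B] [IsScalarTower k A B]
      (b : B), polyMem k N S B (u B b)
  map_zero : ∀ (B : Type u) [CommRing B] [Algebra k B] [Algebra A B] [IsScalarTower k A B],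
      u B 0 = 1
  map_add : ∀ (B : Type u) [CommRing B] [Algebra k B] [Algebra A B] [IsScalarTower k A B]
      (b b' : B), u B (b + b') = u B b * u B b'
  natural : ∀ (B C : Type u) [CommRing B] [Algebra k B] [Algebra A B] [IsScalarTower k A B]
      [CommRing C] [Algebra k C] [Algebra A C] [IsScalarTower k A C]
      (f : B →ₐ[A] C) (b : B), u C (f b) = (u B b).map f

open scoped Polynomial DualNumber

section

variable {k : Type u} [Field k] {N : ℕ} {S : Set (MvPolynomial (Fin N × Fin N) k)}

theorem polyMem_map {B C : Type u} [CommRing B] [Algebra k B] [CommRing C] [Algebra k C]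
    (f : B →ₐ[k] C) {g : Matrix (Fin N) (Fin N) B} (hg : polyMem k N S B g) :
    polyMem k N S C (g.map f) := by
  intro p hp
  exact (MvPolynomial.comp_aeval_apply (φ := f) _ p).symm.trans
    ((congrArg f (hg p hp)).trans (map_zero f))

section Subgroup

variable (hsub : ∀ (A : Type u) [CommRing A] [Algebra k A],
      ∃ H : Subgroup (GL (Fin N) A), ∀ g : GL (Fin N) A,
        g ∈ H ↔ polyMem k N S A (g : Matrix (Fin N) (Fin N) A))
include hsub

theorem polyMem_one (B : Type u) [CommRing B] [Algebra k B] : polyMem k N S B 1 := by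
  obtain ⟨H, hH⟩ := hsub B
  simpa using (hH 1).1 H.one_mem

theorem polyMem_mul {B : Type u} [CommRing B] [Algebra k B] {g h : Matrix (Fin N) (Fin N) B}
    (hgu : IsUnit g) (hhu : IsUnit h) (hg : polyMem k N S B g) (hh : polyMem k N S B h) :
    polyMem k N S B (g * h) := by
  obtain ⟨H, hH⟩ := hsub B
  obtain ⟨g, rfl⟩ := hgu
  obtain ⟨h, rfl⟩ := hhu
  simpa using (hH (g * h)).1 (H.mul_mem ((hH g).2 hg) ((hH h).2 hh))

end Subgroup

/-- The exponential of a nilpotent matrix over a commutative algebra over a field of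
characteristic zero. -/
noncomputable def nilExp (k : Type u) [Field k] [CharZero k] {N : ℕ} {B : Type u} [CommRing B]
    [Algebra k B] (M : Matrix (Fin N) (Fin N) B) : Matrix (Fin N) (Fin N) B :=
  letI : Module ℚ (Matrix (Fin N) (Fin N) B) := Module.compHom _ (algebraMap ℚ k)
  IsNilpotent.exp M

section Exp

variable (k) [CharZero k] {B C : Type u} [CommRing B] [Algebra k B] [CommRing C] [Algebra k C]

theorem nilExp_add {M M' : Matrix (Fin N) (Fin N) B} (h : Commute M M') (hM : IsNilpotent M)
    (hM' : IsNilpotent M') : nilExp k (M + M') = nilExp k M * nilExp k M' :=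
  letI : Module ℚ (Matrix (Fin N) (Fin N) B) := Module.compHom _ (algebraMap ℚ k)
  IsNilpotent.exp_add_of_commute h hM hM'

theorem nilExp_add_smul {M : Matrix (Fin N) (Fin N) B} (hM : IsNilpotent M) (b b' : B) :
    nilExp k ((b + b') • M) = nilExp k (b • M) * nilExp k (b' • M) := by
  rw [add_smul]
  exact nilExp_add k (((Commute.refl M).smul_left b).smul_right b') (hM.smul b) (hM.smul b')

theorem nilExp_zero : nilExp k (0 : Matrix (Fin N) (Fin N) B) = 1 :=
  letI : Module ℚ (Matrix (Fin N) (Fin N) B) := Module.compHom _ (algebraMap ℚ k)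
  IsNilpotent.exp_zero

theorem isUnit_nilExp {M : Matrix (Fin N) (Fin N) B} (hM : IsNilpotent M) :
    IsUnit (nilExp k M) :=
  letI : Module ℚ (Matrix (Fin N) (Fin N) B) := Module.compHom _ (algebraMap ℚ k)
  IsNilpotent.isUnit_exp hM

theorem nilExp_map {M : Matrix (Fin N) (Fin N) B} (hM : IsNilpotent M) (f : B →+* C) :
    (nilExp k M).map f = nilExp k (M.map f) :=
  letI : Module ℚ (Matrix (Fin N) (Fin N) B) := Module.compHom _ (algebraMap ℚ k)
  letI : Module ℚ (Matrix (Fin N) (Fin N) C) := Module.compHom _ (algebraMap ℚ k)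
  IsNilpotent.map_exp hM f.mapMatrix

theorem nilExp_of_sq_eq_zero {M : Matrix (Fin N) (Fin N) B} (hM : M ^ 2 = 0) :
    nilExp k M = 1 + M := by
  let : Module ℚ (Matrix (Fin N) (Fin N) B) := Module.compHom _ (algebraMap ℚ k)
  refine (IsNilpotent.exp_eq_sum hM).trans ?_
  simp [Finset.sum_range_succ]

end Exp

/-- Base change of dual numbers along an algebra map. -/
noncomputable def dualBaseChange (A B : Type u) [CommRing A] [CommRing B] [Algebra A B] :
    A[ε] →ₐ[A] B[ε] :=
  DualNumber.lift ⟨(Algebra.ofId A B[ε], ε), by simp, fun _ => mul_comm _ _⟩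

section Dual

variable {A B : Type u} [CommRing A] [CommRing B] [Algebra A B]

theorem dualBaseChange_apply (z : A[ε]) : dualBaseChange A B z =
    TrivSqZeroExt.inl (algebraMap A B z.fst) + TrivSqZeroExt.inr (algebraMap A B z.snd) := by
  rw [dualBaseChange, DualNumber.lift_apply_apply]
  ext <;> simp [Algebra.ofId_apply, Algebra.algebraMap_eq_smul_one]

theorem dualBaseChange_eps : dualBaseChange A B ε = ε := by
  rw [dualBaseChange_apply]
  ext <;> simp

theorem aeval_inl_add_eps (b : B) (q : A[X]) :
    Polynomial.aeval (TrivSqZeroExt.inl b + ε : B[ε]) q =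
      TrivSqZeroExt.inl (Polynomial.aeval b q) +
        TrivSqZeroExt.inr (Polynomial.aeval b (Polynomial.derivative q)) := by
  have h (r : A[X]) : Polynomial.aeval (TrivSqZeroExt.inl b : B[ε]) r =
      TrivSqZeroExt.inl (Polynomial.aeval b r) :=
    Polynomial.aeval_algHom_apply (TrivSqZeroExt.inlAlgHom A B B) b r
  rw [Polynomial.aeval_add_of_sq_eq_zero _ _ _ DualNumber.eps_pow_two, h, h]
  ext <;> simp

end Dual

/-- The solution of the linear differential equation `U' = U * X` with `U(0) = 1` has the
coefficients of the exponential series. -/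
theorem coeff_of_derivative_eq [CharZero k] {A : Type u} [CommRing A] [Algebra k A]
    {U : Matrix (Fin N) (Fin N) A[X]} {X : Matrix (Fin N) (Fin N) A}
    (h0 : U.map (Polynomial.coeff · 0) = 1)
    (hU : U.map Polynomial.derivative = U * X.map Polynomial.C) (n : ℕ) :
    U.map (Polynomial.coeff · n) = (n.factorial : k)⁻¹ • X ^ n := by
  induction n with
  | zero => simp [h0]
  | succ n ih =>
    have h : U.map (Polynomial.coeff · (n + 1)) * (n + 1 : Matrix (Fin N) (Fin N) A) =
        U.map (Polynomial.coeff · n) * X := by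
      ext i j
      have := congrArg (Polynomial.coeff · n) (congrFun (congrFun hU i) j)
      simp only [Matrix.map_apply, Polynomial.coeff_derivative, Matrix.mul_apply,
        Polynomial.finsetSum_coeff, Polynomial.coeff_mul_C] at this
      rw [← Nat.cast_succ, ← nsmul_eq_mul', Matrix.smul_apply, nsmul_eq_mul', Nat.cast_succ]
      simpa [Matrix.mul_apply] using this
    have hn : ((n + 1 : ℕ) : k) ≠ 0 := Nat.cast_ne_zero.2 n.succ_ne_zero
    rw [← Nat.cast_succ, ← nsmul_eq_mul', ← Nat.cast_smul_eq_nsmul k, ih, smul_mul_assoc,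
      ← pow_succ] at h
    rw [Nat.factorial_succ, Nat.cast_mul, mul_inv, mul_smul, ← h, smul_smul, inv_mul_cancel₀ hn,
      one_smul]

namespace GaHom

variable {A : Type u} [CommRing A] [Algebra k A]

@[ext]
theorem ext' {h h' : GaHom k N S A}
    (H : ∀ (B : Type u) [CommRing B] [Algebra k B] [Algebra A B] [IsScalarTower k A B] (b : B),
      h.u B b = h'.u B b) : h = h' := by
  cases h
  cases h'
  congr
  funext B _ _ _ _ b
  exact H B b

/-- The derivative at the identity of a one-parameter subgroup. -/
def deriv (h : GaHom k N S A) : Matrix (Fin N) (Fin N) A :=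
  fun i j => (h.u A[ε] ε i j).snd

theorem u_eps (h : GaHom k N S A) :
    h.u A[ε] ε = 1 + h.deriv.map (TrivSqZeroExt.inr : A → A[ε]) := by
  have h1 := h.natural A[ε] A (TrivSqZeroExt.fstHom A A A) ε
  rw [TrivSqZeroExt.fstHom_apply, DualNumber.fst_eps, h.map_zero] at h1
  ext i j
  · refine (congrFun (congrFun h1 i) j).symm.trans ?_
    obtain rfl | hij := eq_or_ne i j <;> simp [*]
  · by_cases hij : i = j <;> simp [deriv, hij]

/-- The universal point of a one-parameter subgroup. -/
noncomputable def univ (h : GaHom k N S A) : Matrix (Fin N) (Fin N) A[X] :=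
  h.u A[X] Polynomial.X

theorem u_eq_univ_map (h : GaHom k N S A) (B : Type u) [CommRing B] [Algebra k B] [Algebra A B]
    [IsScalarTower k A B] (b : B) : h.u B b = h.univ.map (Polynomial.aeval (R := A) b) := by
  rw [univ, ← h.natural, Polynomial.aeval_X]

theorem univ_coeff_zero (h : GaHom k N S A) : h.univ.map (Polynomial.coeff · 0) = 1 := by
  rw [← h.map_zero A, h.u_eq_univ_map]
  ext i j
  simp [Polynomial.coeff_zero_eq_aeval_zero]

theorem univ_derivative (h : GaHom k N S A) :
    h.univ.map Polynomial.derivative = h.univ * h.deriv.map Polynomial.C := by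
  have h1 := h.map_add A[X][ε] (TrivSqZeroExt.inl Polynomial.X) ε
  rw [h.u_eq_univ_map, h.u_eq_univ_map _ (TrivSqZeroExt.inl Polynomial.X),
    ← dualBaseChange_eps (A := A), h.natural, u_eps, dualBaseChange_eps] at h1
  have h2 : (1 + h.deriv.map (TrivSqZeroExt.inr : A → A[ε])).map (dualBaseChange A A[X]) =
      1 + (h.deriv.map Polynomial.C).map (TrivSqZeroExt.inr : A[X] → A[X][ε]) := by
    rw [Matrix.map_add _ (_root_.map_add _), Matrix.map_one _ (_root_.map_zero _) (map_one _)]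
    congr 1
    ext1 i j
    simp [dualBaseChange_apply, -DualNumber.inr_eq_smul_eps]
  rw [h2, mul_add, mul_one] at h1
  ext1 i j
  have h3 := congrArg TrivSqZeroExt.snd (congrFun (congrFun h1 i) j)
  have h4 (r : A[X]) : Polynomial.aeval (TrivSqZeroExt.inl Polynomial.X : A[X][ε]) r =
      TrivSqZeroExt.inl r := by
    have := Polynomial.aeval_algHom_apply (TrivSqZeroExt.inlAlgHom A A[X] A[X]) Polynomial.X r
    simpa using this
  simpa [aeval_inl_add_eps, h4, Matrix.mul_apply, TrivSqZeroExt.snd_sum, mul_comm] using h3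

theorem univ_coeff [CharZero k] (h : GaHom k N S A) (n : ℕ) :
    h.univ.map (Polynomial.coeff · n) = (n.factorial : k)⁻¹ • h.deriv ^ n :=
  coeff_of_derivative_eq h.univ_coeff_zero h.univ_derivative n

theorem isNilpotent_deriv [CharZero k] (h : GaHom k N S A) : IsNilpotent h.deriv := by
  let d := Finset.univ.sup fun q : Fin N × Fin N => (h.univ q.1 q.2).natDegree
  refine ⟨d + 1, ?_⟩
  have h0 : h.univ.map (Polynomial.coeff · (d + 1)) = 0 := by
    ext i j
    exact Polynomial.coeff_eq_zero_of_natDegree_lt (Nat.lt_succ_of_le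
      (Finset.le_sup (f := fun q : Fin N × Fin N => (h.univ q.1 q.2).natDegree)
        (Finset.mem_univ (i, j))))
  rw [h.univ_coeff] at h0
  exact (smul_eq_zero_iff_right
    (inv_ne_zero (Nat.cast_ne_zero.2 (Nat.factorial_ne_zero _)))).1 h0

theorem deriv_injective [CharZero k] :
    Function.Injective (deriv : GaHom k N S A → Matrix (Fin N) (Fin N) A) := by
  intro h h' hd
  have : h.univ = h'.univ := by
    ext i j n
    have := (h.univ_coeff n).trans ((congrArg _ (congrArg (· ^ n) hd)).trans
      (h'.univ_coeff n).symm)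
    exact congrFun (congrFun this i) j
  ext1 B _ _ _ _ b
  rw [u_eq_univ_map, u_eq_univ_map, this]

theorem polyMem_deriv (h : GaHom k N S A) :
    polyMem k N S A[ε] (1 + h.deriv.map (TrivSqZeroExt.inr : A → A[ε])) :=
  h.u_eps ▸ h.mem A[ε] ε

end GaHom

/-- In characteristic zero, an ideal of polynomials which is stable under differentiation and
whose elements all vanish at the origin is zero. -/
theorem eq_zero_of_mem_of_derivative_mem [CharZero k] {A : Type u} [CommRing A] [Algebra k A]
    {K : Ideal A[X]} (hK : ∀ q ∈ K, Polynomial.derivative q ∈ K)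
    (h0 : ∀ q ∈ K, q.coeff 0 = 0) {q : A[X]} (hq : q ∈ K) : q = 0 := by
  have h (n : ℕ) : ∀ q ∈ K, q.coeff n = 0 := by
    induction n with
    | zero => exact h0
    | succ n ih =>
      intro q hq
      have := ih _ (hK q hq)
      rw [Polynomial.coeff_derivative, ← Nat.cast_succ, ← nsmul_eq_mul',
        ← Nat.cast_smul_eq_nsmul k] at this
      exact (smul_eq_zero_iff_right (Nat.cast_ne_zero.2 n.succ_ne_zero)).1 this
  exact Polynomial.ext fun n => by simpa using h n q hq

theorem isNilpotent_smul_map {A B : Type u} [CommRing A] [CommRing B]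
    {X : Matrix (Fin N) (Fin N) A} (hX : IsNilpotent X) (f : A →+* B) (b : B) :
    IsNilpotent (b • X.map f) :=
  (hX.map f.mapMatrix).smul b

theorem eps_smul_map {A B : Type u} [CommRing A] [CommRing B] [Algebra A B]
    (X : Matrix (Fin N) (Fin N) A) :
    (ε : B[ε]) • X.map (algebraMap A B[ε]) =
      (X.map (TrivSqZeroExt.inr : A → A[ε])).map (dualBaseChange A B) := by
  ext i j <;> simp [dualBaseChange_apply, Algebra.algebraMap_eq_smul_one]

theorem nilExp_eps [CharZero k] {A B : Type u} [CommRing A] [Algebra k A] [CommRing B]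
    [Algebra k B] [Algebra A B] (X : Matrix (Fin N) (Fin N) A) :
    nilExp k ((ε : B[ε]) • X.map (algebraMap A B[ε])) =
      (1 + X.map (TrivSqZeroExt.inr : A → A[ε])).map (dualBaseChange A B) := by
  rw [nilExp_of_sq_eq_zero, eps_smul_map, Matrix.map_add _ (_root_.map_add _),
    Matrix.map_one _ (_root_.map_zero _) (map_one _)]
  rw [smul_pow, DualNumber.eps_pow_two, zero_smul]

section Exponential

variable [CharZero k]
  (hsub : ∀ (A : Type u) [CommRing A] [Algebra k A],
      ∃ H : Subgroup (GL (Fin N) A), ∀ g : GL (Fin N) A,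
        g ∈ H ↔ polyMem k N S A (g : Matrix (Fin N) (Fin N) A))
  {A : Type u} [CommRing A] [Algebra k A] {X : Matrix (Fin N) (Fin N) A}
  (hX : IsNilpotent X)
  (hXG : polyMem k N S A[ε] (1 + X.map (TrivSqZeroExt.inr : A → A[ε])))

theorem nilExp_smul_map_algHom {A : Type u} [CommRing A] {X : Matrix (Fin N) (Fin N) A}
    (hX : IsNilpotent X) {B C : Type u} [CommRing B] [Algebra k B] [Algebra A B]
    [CommRing C] [Algebra k C] [Algebra A C] (f : B →ₐ[A] C) (b : B) :
    (nilExp k (b • X.map (algebraMap A B))).map f =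
      nilExp k (f b • X.map (algebraMap A C)) := by
  refine (nilExp_map k (isNilpotent_smul_map hX _ b) (f : B →+* C)).trans ?_
  congr 1
  ext i j
  simp

theorem aeval_nilExp_map {A : Type u} [CommRing A] [Algebra k A]
    {X : Matrix (Fin N) (Fin N) A} (hX : IsNilpotent X) {C : Type u} [CommRing C] [Algebra k C]
    [Algebra A C] [IsScalarTower k A C] (f : A[X] →ₐ[A] C)
    (p : MvPolynomial (Fin N × Fin N) k) :
    MvPolynomial.aeval (fun q : Fin N × Fin N =>
        nilExp k (f Polynomial.X • X.map (algebraMap A C)) q.1 q.2) p =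
      f (MvPolynomial.aeval (fun q : Fin N × Fin N =>
        nilExp k ((Polynomial.X : A[X]) • X.map (algebraMap A A[X])) q.1 q.2) p) := by
  rw [← nilExp_smul_map_algHom hX f]
  exact (MvPolynomial.comp_aeval_apply (φ := f.restrictScalars k) _ p).symm

include hsub hX hXG

theorem polyMem_nilExp_inl_add_eps {B : Type u} [CommRing B] [Algebra k B] [Algebra A B]
    [IsScalarTower k A B] {b : B} (hb : polyMem k N S B (nilExp k (b • X.map (algebraMap A B)))) :
    polyMem k N S B[ε]
      (nilExp k ((TrivSqZeroExt.inl b + ε : B[ε]) • X.map (algebraMap A B[ε]))) := by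
  rw [nilExp_add_smul k (M := X.map (algebraMap A B[ε])) (hX.map (algebraMap A B[ε]).mapMatrix)]
  refine polyMem_mul hsub (isUnit_nilExp k (isNilpotent_smul_map hX _ _))
    (isUnit_nilExp k (isNilpotent_smul_map hX _ _)) ?_ ?_
  · have := polyMem_map ((TrivSqZeroExt.inlAlgHom A B B).restrictScalars k) hb
    exact nilExp_smul_map_algHom (k := k) hX (TrivSqZeroExt.inlAlgHom A B B) b ▸ this
  · rw [nilExp_eps]
    exact polyMem_map ((dualBaseChange A B).restrictScalars k) hXG

theorem map_derivative_aeval_nilExp {B : Type u} [CommRing B] [Algebra k B] [Algebra A B]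
    [IsScalarTower k A B] {f : A[X] →ₐ[A] B}
    (hf : polyMem k N S B (nilExp k (f Polynomial.X • X.map (algebraMap A B))))
    {p : MvPolynomial (Fin N × Fin N) k} (hp : p ∈ S) :
    f (Polynomial.derivative (MvPolynomial.aeval (fun q : Fin N × Fin N =>
        nilExp k ((Polynomial.X : A[X]) • X.map (algebraMap A A[X])) q.1 q.2) p)) = 0 := by
  have h := aeval_nilExp_map hX
    (Polynomial.aeval (TrivSqZeroExt.inl (f Polynomial.X) + ε : B[ε])) p
  rw [Polynomial.aeval_X, polyMem_nilExp_inl_add_eps hsub hX hXG hf p hp, aeval_inl_add_eps] at h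
  have h2 := congrArg TrivSqZeroExt.snd h
  simp only [TrivSqZeroExt.snd_zero, TrivSqZeroExt.snd_add, TrivSqZeroExt.snd_inl,
    TrivSqZeroExt.snd_inr, zero_add] at h2
  rw [h2, Polynomial.aeval_algHom_apply, Polynomial.aeval_X_left_apply]

theorem polyMem_nilExp_X :
    polyMem k N S A[X]
      (nilExp k ((Polynomial.X : A[X]) • X.map (algebraMap A A[X]))) := by
  let F : MvPolynomial (Fin N × Fin N) k → A[X] := MvPolynomial.aeval fun q =>
    nilExp k ((Polynomial.X : A[X]) • X.map (algebraMap A A[X])) q.1 q.2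
  let K : Ideal A[X] := Ideal.span (F '' S)
  have hFK {p} (hp : p ∈ S) : F p ∈ K := Ideal.subset_span ⟨p, hp, rfl⟩
  have hquot : polyMem k N S (A[X] ⧸ K)
      (nilExp k (Ideal.Quotient.mkₐ A K Polynomial.X • X.map (algebraMap A (A[X] ⧸ K)))) :=
    fun p hp => (aeval_nilExp_map hX (Ideal.Quotient.mkₐ A K) p).trans
      (Ideal.Quotient.eq_zero_iff_mem.2 (hFK hp))
  have hder : ∀ q ∈ K, Polynomial.derivative q ∈ K := by
    intro q hq
    induction hq using Submodule.span_induction with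
    | mem q hq =>
      obtain ⟨p, hp, rfl⟩ := hq
      exact Ideal.Quotient.eq_zero_iff_mem.1 (map_derivative_aeval_nilExp hsub hX hXG hquot hp)
    | zero => simp
    | add q r _ _ hq hr => simpa using K.add_mem hq hr
    | smul a q hq' hq =>
      rw [smul_eq_mul, Polynomial.derivative_mul]
      exact K.add_mem (K.mul_mem_left _ hq') (K.mul_mem_left _ hq)
  have hzero : ∀ q ∈ K, q.coeff 0 = 0 := by
    have : K ≤ RingHom.ker (Polynomial.aeval (0 : A) : A[X] →ₐ[A] A) := by
      refine Ideal.span_le.2 ?_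
      rintro _ ⟨p, hp, rfl⟩
      refine (aeval_nilExp_map hX (Polynomial.aeval (0 : A)) p).symm.trans ?_
      rw [Polynomial.aeval_X, zero_smul, nilExp_zero]
      exact polyMem_one hsub A p hp
    intro q hq
    rw [Polynomial.coeff_zero_eq_aeval_zero]
    exact this hq
  exact fun p hp => eq_zero_of_mem_of_derivative_mem (k := k) hder hzero (hFK hp)

theorem polyMem_nilExp_smul (B : Type u) [CommRing B] [Algebra k B] [Algebra A B]
    [IsScalarTower k A B] (b : B) :
    polyMem k N S B (nilExp k (b • X.map (algebraMap A B))) := by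
  have h := polyMem_map ((Polynomial.aeval (R := A) b).restrictScalars k)
    (polyMem_nilExp_X hsub hX hXG)
  have h2 := nilExp_smul_map_algHom (k := k) hX (Polynomial.aeval (R := A) b) Polynomial.X
  rw [Polynomial.aeval_X] at h2
  exact h2 ▸ h

/-- The one-parameter subgroup `t ↦ exp (t X)`. -/
noncomputable def GaHom.ofNilpotent : GaHom k N S A where
  u B _ _ _ _ b := nilExp k (b • X.map (algebraMap A B))
  mem B _ _ _ _ b := polyMem_nilExp_smul hsub hX hXG B b
  map_zero B _ _ _ _ := by rw [zero_smul, nilExp_zero]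
  map_add B _ _ _ _ b b' :=
    nilExp_add_smul k (hX.map (algebraMap A B).mapMatrix) b b'
  natural B C _ _ _ _ _ _ _ _ f b := (nilExp_smul_map_algHom hX f b).symm

theorem GaHom.deriv_ofNilpotent : (GaHom.ofNilpotent hsub hX hXG).deriv = X := by
  ext i j
  have h : (GaHom.ofNilpotent hsub hX hXG).u A[ε] ε = _ := nilExp_eps (k := k) (B := A) X
  rw [GaHom.deriv, h]
  by_cases hij : i = j <;> simp [dualBaseChange_apply, hij]

end Exponential

end

/-- For an affine algebraic group `G` over a field `k` of characteristic
zero (realized as a linear algebraic group inside `GL_N`) and a finite-dimensional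
`k`-algebra `A`, there is a natural bijection between homomorphisms of `A`-group schemes
`𝔾_{a,A} → G_A` and nilpotent elements of `Lie_A(G_A)`; the bijection is given by taking
the derivative at the identity, i.e. the `ε`-coefficient of `u(ε) ∈ G(A[ε])`. -/
theorem stmt_7 (k : Type u) [Field k] [CharZero k] (N : ℕ)
    (S : Set (MvPolynomial (Fin N × Fin N) k))
    (hsub : ∀ (A : Type u) [CommRing A] [Algebra k A],
      ∃ H : Subgroup (GL (Fin N) A), ∀ g : GL (Fin N) A,
        g ∈ H ↔ polyMem k N S A (g : Matrix (Fin N) (Fin N) A))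
    (A : Type u) [CommRing A] [Algebra k A] [FiniteDimensional k A] :
    ∃ e : GaHom k N S A ≃
        {X : Matrix (Fin N) (Fin N) A //
          IsNilpotent X ∧
          polyMem k N S (DualNumber A)
            ((1 : Matrix (Fin N) (Fin N) (DualNumber A)) +
              X.map (fun a => (TrivSqZeroExt.inr a : DualNumber A)))},
      ∀ h : GaHom k N S A,
        ((e h : {X : Matrix (Fin N) (Fin N) A // _}) : Matrix (Fin N) (Fin N) A) =
          fun i j => TrivSqZeroExt.snd (h.u (DualNumber A) DualNumber.eps i j) := by
  refine ⟨Equiv.ofBijective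
    (fun h => ⟨h.deriv, h.isNilpotent_deriv, h.polyMem_deriv⟩) ⟨?_, ?_⟩, fun h => rfl⟩
  · intro h h' hd
    exact GaHom.deriv_injective (congrArg Subtype.val hd)
  · rintro ⟨_, hX, hXG⟩
    exact ⟨GaHom.ofNilpotent hsub hX hXG, Subtype.ext (GaHom.deriv_ofNilpotent hsub hX hXG)⟩
end
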